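/- Let q be a power of a prime p, d a power of p, and f̂ = f̂_1 x + f̂_0 ∈ F_q[t][x] with f̂_1 ≠ 0 and gcd(f̂_1, f̂_0) = 1; set f = f̂(x^d) = f̂_1 x^d + f̂_0. Assume that for every monic irreducible ℓ ∈ F_q[t] there is no polynomial r ∈ F_q[t] with deg r < 2·deg ℓ such that f(r) ≡ 0 (mod ℓ²), nor any r with ℓ | r, deg r < 2·deg ℓ and F(1,r) ≡ 0 (mod ℓ²) where F(X,Y) = f̂_1 X^d + f̂_0 Y^d is the homogenization of f. Then α_ℓ(f) exists for every monic irreducible ℓ, and α(f) := lim_{b_0 → ∞} Σ_{ℓ monic irreducible, deg ℓ ≤ b_0} α_ℓ(f) = 2/(q − 1). -/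

import Mathlib

open Polynomial Filter

theorem hasSum_of_sum_divisors_eq_pow {q : ℝ} (hq : 1 < q) {w : ℕ → ℝ} (hw : ∀ m, 0 ≤ w m)
    (hw0 : w 0 = 0) (hsum : ∀ n, 0 < n → ∑ m ∈ n.divisors, w m = q ^ n) :
    HasSum (fun m : ℕ => w m * (1 / (q ^ (2 * m) - 1))) (1 / (q - 1)) := by
  have hq0 : 0 < q := by linarith
  have hr0 : 0 ≤ q⁻¹ := by positivity
  have hr1 : q⁻¹ < 1 := inv_lt_one_of_one_lt₀ hq
  let f : ℕ+ × ℕ+ → ℝ := fun x => w x.1 * (q⁻¹ ^ (2 * (x.1 : ℕ))) ^ (x.2 : ℕ)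
  have geom : ∀ r : ℝ, 0 ≤ r → r < 1 → HasSum (fun k : ℕ+ => r ^ (k : ℕ)) ((1 - r)⁻¹ - 1) := by
    intro r h0 h1
    rw [hasSum_pnat_iff (f := fun k => r ^ k)]
    simpa using hasSum_geometric_of_lt_one h0 h1
  have fiber : ∀ n : ℕ+, HasSum
      (fun y : Nat.divisorsAntidiagonal n => f (sigmaAntidiagonalEquivProd ⟨n, y⟩))
      (q⁻¹ ^ (n : ℕ)) := by
    intro n
    have h1 : ∀ y : Nat.divisorsAntidiagonal n,
        f (sigmaAntidiagonalEquivProd ⟨n, y⟩) = w y.1.1 * q⁻¹ ^ (2 * (n : ℕ)) := by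
      intro y
      have := (Nat.mem_divisorsAntidiagonal.mp y.2).1
      change w y.1.1 * (q⁻¹ ^ (2 * (y.1.1 : ℕ))) ^ (y.1.2 : ℕ) = _
      rw [← pow_mul, mul_assoc, this]
    simp_rw [h1]
    convert hasSum_fintype _ using 1
    rw [Finset.sum_coe_sort (Nat.divisorsAntidiagonal n)
      (fun y => w y.1 * q⁻¹ ^ (2 * (n : ℕ))), ← Finset.sum_mul,
      Nat.sum_divisorsAntidiagonal (fun m _ => w m), hsum n n.pos, two_mul, pow_add, ← mul_assoc,
      ← mul_pow, mul_inv_cancel₀ hq0.ne', one_pow, one_mul]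
  have hf0 : ∀ x, 0 ≤ f x := fun x => by
    have := hw x.1
    positivity
  have hG := geom _ hr0 hr1
  have hsm : Summable (fun x => f (sigmaAntidiagonalEquivProd x)) := by
    rw [summable_sigma_of_nonneg (fun x => hf0 _)]
    refine ⟨fun n => (fiber n).summable, ?_⟩
    simp_rw [fun n => (fiber n).tsum_eq]
    exact hG.summable
  have htot : HasSum f (1 / (q - 1)) := by
    rw [← sigmaAntidiagonalEquivProd.hasSum_iff]
    have h2 := hsm.hasSum.sigma fiber
    have h3 := hG.unique h2
    have h4 : (1 - q⁻¹)⁻¹ - 1 = 1 / (q - 1) := by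
      have : q - 1 ≠ 0 := by linarith
      have h : 1 - q⁻¹ = (q - 1) / q := by field_simp
      rw [h]
      field_simp
      ring
    rw [← h4, h3]
    exact hsm.hasSum
  have hfin := htot.prod_fiberwise (g := fun m : ℕ+ => w m * (1 / (q ^ (2 * (m : ℕ)) - 1))) (by
    intro m
    have hm : 1 < q ^ (2 * (m : ℕ)) := one_lt_pow₀ hq (by simp)
    convert (geom (q⁻¹ ^ (2 * (m : ℕ))) (by positivity)
      (pow_lt_one₀ hr0 hr1 (by simp))).mul_left (w m) using 1
    congr 1
    set Q := q ^ (2 * (m : ℕ))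
    have : Q - 1 ≠ 0 := by linarith
    have h : 1 - q⁻¹ ^ (2 * (m : ℕ)) = (Q - 1) / Q := by
      rw [inv_pow]
      field_simp
      change (Q - 1) * Q = Q * (Q - 1)
      ring
    rw [h]
    field_simp
    ring)
  rw [hasSum_pnat_iff (f := fun m : ℕ => w m * (1 / (q ^ (2 * m) - 1)))] at hfin
  simpa [hw0] using hfin

theorem finite_setOf_degree_lt (F : Type*) [Field F] [Finite F] (n : ℕ) :
    {P : F[X] | P.degree < n}.Finite := by
  have : Finite (degreeLT F n) := Finite.of_equiv _ (degreeLTEquiv F n).toEquiv.symm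
  convert Set.toFinite ((degreeLT F n : Submodule F F[X]) : Set F[X])
  ext P
  simp [mem_degreeLT]

theorem finite_setOf_natDegree_eq (F : Type*) [Field F] [Finite F] (n : ℕ) :
    {P : F[X] | P.natDegree = n}.Finite := by
  refine (finite_setOf_degree_lt F (n + 1)).subset fun P hP => ?_
  rw [Set.mem_ofPred_eq] at hP ⊢
  exact degree_le_natDegree.trans_lt (by rw [hP]; exact_mod_cast Nat.lt_succ_self n)

theorem sum_divisors_mul_ncard_irreducible (F : Type*) [Field F] [Finite F] {n : ℕ} (hn : 0 < n) :
    ∑ m ∈ n.divisors, m * {ℓ : F[X] | ℓ.Monic ∧ Irreducible ℓ ∧ ℓ.natDegree = m}.ncard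
      = Nat.card F ^ n := by
  classical
  set q := Nat.card F with hq
  have hq1 : 1 < q := Finite.one_lt_card
  set g : F[X] := X ^ q ^ n - X with hg
  have hg0 : g ≠ 0 := FiniteField.X_pow_card_pow_sub_X_ne_zero F hn.ne' hq1
  have hdeg : g.natDegree = q ^ n := FiniteField.X_pow_card_pow_sub_X_natDegree_eq F hn.ne' hq1
  have hsq : Squarefree g := by
    obtain ⟨p, hp⟩ := CharP.exists F
    refine (galois_poly_separable p _ ?_).squarefree
    refine dvd_pow ?_ hn.ne'
    rw [← CharP.cast_eq_zero_iff F p, hq]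
    have := Fintype.ofFinite F
    simp [Nat.card_eq_fintype_card]
  set S := UniqueFactorizationMonoid.normalizedFactors g with hS
  have hmem : ∀ ℓ, ℓ ∈ S ↔ ℓ.Monic ∧ Irreducible ℓ ∧ ℓ.natDegree ∣ n := by
    intro ℓ
    rw [hS, UniqueFactorizationMonoid.mem_normalizedFactors_iff' hg0]
    constructor
    · rintro ⟨h1, h2, h3⟩
      exact ⟨h2 ▸ monic_normalize h1.ne_zero, h1,
        h1.natDegree_dvd_iff_dvd_X_pow_card_pow_sub_X.2 h3⟩
    · rintro ⟨h1, h2, h3⟩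
      exact ⟨h2, h1.normalize_eq_self, h2.natDegree_dvd_iff_dvd_X_pow_card_pow_sub_X.1 h3⟩
  have hnd : S.Nodup := (UniqueFactorizationMonoid.squarefree_iff_nodup_normalizedFactors hg0).1 hsq
  have hprod : (S.map natDegree).sum = q ^ n := by
    rw [← natDegree_multiset_prod_of_monic _ fun ℓ h => ((hmem ℓ).1 h).1, hS,
      UniqueFactorizationMonoid.prod_normalizedFactors_eq hg0, ← hdeg]
    exact natDegree_eq_of_degree_eq (degree_normalize)
  let T : Finset F[X] := ⟨S, hnd⟩
  have hT : ∑ ℓ ∈ T, ℓ.natDegree = q ^ n := hprod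
  rw [← hT, ← Finset.sum_fiberwise_of_maps_to (s := T) (t := n.divisors) (g := natDegree)
    (fun ℓ h => Nat.mem_divisors.2 ⟨((hmem ℓ).1 h).2.2, hn.ne'⟩)]
  refine Finset.sum_congr rfl fun m hm => ?_
  rw [Finset.sum_congr rfl (fun ℓ h => (Finset.mem_filter.1 h).2), Finset.sum_const, smul_eq_mul,
    mul_comm, ← Set.ncard_coe_finset]
  congr 2
  ext ℓ
  have := Nat.dvd_of_mem_divisors hm
  have h2 : ℓ ∈ T ↔ ℓ ∈ S := Iff.rfl
  simp only [Set.mem_ofPred_eq, Finset.coe_filter, h2, hmem]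
  constructor
  · rintro ⟨h1, h2, h3⟩
    exact ⟨⟨h1, h2, h3 ▸ this⟩, h3⟩
  · rintro ⟨⟨h1, h2, -⟩, h3⟩
    exact ⟨h1, h2, h3⟩

theorem tendsto_sum_monic_irreducible (F : Type*) [Field F] [Finite F] :
    Tendsto (fun b : ℕ => ∑ᶠ ℓ ∈ {ℓ : F[X] | ℓ.Monic ∧ Irreducible ℓ ∧ ℓ.degree ≤ (b : WithBot ℕ)},
      (ℓ.natDegree : ℝ) * (1 / ((Nat.card F : ℝ) ^ (2 * ℓ.natDegree) - 1)))
      atTop (nhds (1 / ((Nat.card F : ℝ) - 1))) := by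
  classical
  set w : ℕ → ℝ := fun m =>
    ((m * {ℓ : F[X] | ℓ.Monic ∧ Irreducible ℓ ∧ ℓ.natDegree = m}.ncard : ℕ) : ℝ) with hw
  have h := (hasSum_of_sum_divisors_eq_pow (q := Nat.card F) (w := w)
    (by exact_mod_cast Finite.one_lt_card) (fun m => by positivity) (by simp [hw])
    (fun n hn => by
      simp only [hw]
      exact_mod_cast sum_divisors_mul_ncard_irreducible F hn)).tendsto_sum_nat
  refine (h.comp (tendsto_add_atTop_nat 1)).congr fun b => ?_
  have hfin : {ℓ : F[X] | ℓ.Monic ∧ Irreducible ℓ ∧ ℓ.degree ≤ (b : WithBot ℕ)}.Finite := by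
    refine (finite_setOf_degree_lt F (b + 1)).subset fun P hP => ?_
    exact hP.2.2.trans_lt (by exact_mod_cast Nat.lt_succ_self b)
  rw [finsum_mem_eq_finite_toFinset_sum _ hfin]
  rw [← Finset.sum_fiberwise_of_maps_to (s := hfin.toFinset) (t := Finset.range (b + 1))
    (g := natDegree) (fun ℓ h => by
      rw [Set.Finite.mem_toFinset] at h
      exact Finset.mem_range.2 (Nat.lt_succ_of_le (natDegree_le_iff_degree_le.2 h.2.2)))]
  refine Finset.sum_congr rfl fun m hm => ?_
  rw [Finset.sum_congr rfl (g := fun _ => (m : ℝ) * (1 / ((Nat.card F : ℝ) ^ (2 * m) - 1)))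
    (fun ℓ h => by rw [(Finset.mem_filter.1 h).2]), Finset.sum_const, nsmul_eq_mul,
    ← Set.ncard_coe_finset]
  have : ((hfin.toFinset.filter fun ℓ => ℓ.natDegree = m : Finset F[X]) : Set F[X])
      = {ℓ : F[X] | ℓ.Monic ∧ Irreducible ℓ ∧ ℓ.natDegree = m} := by
    ext ℓ
    simp only [Finset.coe_filter, Set.Finite.mem_toFinset, Set.mem_ofPred_eq]
    constructor
    · rintro ⟨⟨h1, h2, -⟩, h3⟩
      exact ⟨h1, h2, h3⟩
    · rintro ⟨h1, h2, h3⟩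
      refine ⟨⟨h1, h2, natDegree_le_iff_degree_le.1 ?_⟩, h3⟩
      rw [h3]
      exact Nat.lt_succ_iff.1 (Finset.mem_range.1 hm)
  rw [this]
  simp only [hw]
  push_cast
  ring

theorem tendsto_of_affine_recurrence {m : ℕ} (hm : 0 < m) {r s : ℝ} (hr0 : 0 ≤ r) (hr1 : r < 1)
    {e : ℕ → ℝ} (he : ∀ k, e (k + m) = r * e k + s) :
    Tendsto e atTop (nhds (s / (1 - r))) := by
  have hr : 1 - r ≠ 0 := by linarith
  set L := s / (1 - r) with hL
  have hLs : s = L * (1 - r) := by rw [hL]; field_simp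
  have hstep : ∀ j i, e (i + m * j) - L = r ^ j * (e i - L) := by
    intro j i
    induction j with
    | zero => simp
    | succ j ih =>
      rw [mul_add, mul_one, ← add_assoc, he, pow_succ]
      linear_combination r * ih + hLs
  set M := ∑ i ∈ Finset.range m, |e i - L|
  have hbound : ∀ k, ‖e k - L‖ ≤ r ^ (k / m) * M := by
    intro k
    have h1 := hstep (k / m) (k % m)
    rw [Nat.mod_add_div] at h1
    rw [h1, norm_mul, Real.norm_eq_abs, Real.norm_eq_abs, abs_of_nonneg (pow_nonneg hr0 _)]
    exact mul_le_mul_of_nonneg_left (Finset.single_le_sum (f := fun i => |e i - L|)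
      (fun i _ => abs_nonneg _) (Finset.mem_range.2 (Nat.mod_lt _ hm))) (pow_nonneg hr0 _)
  have h0 : Tendsto (fun k => r ^ (k / m) * M) atTop (nhds 0) := by
    simpa using ((tendsto_pow_atTop_nhds_zero_of_lt_one hr0 hr1).comp
      (Nat.tendsto_div_const_atTop hm.ne')).mul_const M
  simpa using (squeeze_zero_norm hbound h0).add_const L

theorem degree_le_natCast_iff_lt_succ {F : Type*} [Field F] {P : F[X]} {n : ℕ} :
    P.degree ≤ (n : WithBot ℕ) ↔ P.degree < ((n + 1 : ℕ) : WithBot ℕ) := by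
  rw [← natDegree_le_iff_degree_le]
  by_cases hP : P = 0
  · simp [hP]
  · rw [← natDegree_lt_iff_degree_lt hP, Nat.lt_succ_iff]

theorem ncard_setOf_degree_lt (F : Type*) [Field F] [Finite F] (n : ℕ) :
    {P : F[X] | P.degree < n}.ncard = Nat.card F ^ n := by
  have h : {P : F[X] | P.degree < n} = ((degreeLT F n : Submodule F F[X]) : Set F[X]) := by
    ext P
    simp [mem_degreeLT]
  rw [h, ← Nat.card_coe_set_eq]
  refine (Nat.card_congr (degreeLTEquiv F n).toEquiv).trans ?_
  rw [Nat.card_fun, Nat.card_fin]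

theorem ncard_ne_zero_degree_lt (F : Type*) [Field F] [Finite F] (n : ℕ) :
    ({P : F[X] | P ≠ 0 ∧ P.degree < n}.ncard : ℝ) = (Nat.card F : ℝ) ^ n - 1 := by
  have h : {P : F[X] | P ≠ 0 ∧ P.degree < n} = {P : F[X] | P.degree < n} \ {0} := by
    ext P
    simp [and_comm]
  rw [h, Set.cast_ncard_sdiff (by simp) (finite_setOf_degree_lt F n),
    ncard_setOf_degree_lt]
  simp

theorem finsum_multiplicity_recurrence {F : Type*} [Field F] [Finite F] {ℓ : F[X]}
    (hℓ : Irreducible ℓ) (n : ℕ) :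
    ∑ᶠ P ∈ {P : F[X] | P ≠ 0 ∧ P.degree < ((n + ℓ.natDegree : ℕ) : WithBot ℕ)},
        (multiplicity ℓ P : ℝ)
      = ∑ᶠ P ∈ {P : F[X] | P ≠ 0 ∧ P.degree < n}, (multiplicity ℓ P : ℝ)
        + ((Nat.card F : ℝ) ^ n - 1) := by
  have hfin : {P : F[X] | P ≠ 0 ∧ P.degree < n}.Finite :=
    (finite_setOf_degree_lt F n).subset fun P hP => hP.2
  have hdeg : ∀ P : F[X], P ≠ 0 →
      ((ℓ * P).degree < ((n + ℓ.natDegree : ℕ) : WithBot ℕ) ↔ P.degree < n) := by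
    intro P hP
    rw [← natDegree_lt_iff_degree_lt (mul_ne_zero hℓ.ne_zero hP), natDegree_mul hℓ.ne_zero hP,
      ← natDegree_lt_iff_degree_lt hP]
    omega
  have h1 : ∑ᶠ P ∈ {P : F[X] | P ≠ 0 ∧ P.degree < ((n + ℓ.natDegree : ℕ) : WithBot ℕ)},
      (multiplicity ℓ P : ℝ)
      = ∑ᶠ P ∈ (fun P => ℓ * P) '' {P : F[X] | P ≠ 0 ∧ P.degree < n}, (multiplicity ℓ P : ℝ) := by
    apply finsum_mem_inter_support_eq
    ext P
    simp only [Set.mem_inter_iff, Set.mem_ofPred_eq, Set.mem_image, Function.mem_support, ne_eq,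
      Nat.cast_eq_zero, multiplicity_eq_zero, not_not]
    constructor
    · rintro ⟨⟨h1, h2⟩, Q, rfl⟩
      have hQ : Q ≠ 0 := right_ne_zero_of_mul h1
      exact ⟨⟨Q, ⟨hQ, (hdeg Q hQ).1 h2⟩, rfl⟩, dvd_mul_right _ _⟩
    · rintro ⟨⟨Q, ⟨hQ, h2⟩, rfl⟩, h3⟩
      exact ⟨⟨mul_ne_zero hℓ.ne_zero hQ, (hdeg Q hQ).2 h2⟩, h3⟩
  rw [h1, finsum_mem_image ((mul_right_injective₀ hℓ.ne_zero).injOn)]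
  have h2 : ∑ᶠ P ∈ {P : F[X] | P ≠ 0 ∧ P.degree < n}, (multiplicity ℓ (ℓ * P) : ℝ)
      = ∑ᶠ P ∈ {P : F[X] | P ≠ 0 ∧ P.degree < n}, ((multiplicity ℓ P : ℝ) + 1) := by
    refine finsum_mem_congr rfl fun P hP => ?_
    rw [multiplicity_mul hℓ.prime
      (FiniteMultiplicity.of_prime_left hℓ.prime (mul_ne_zero hℓ.ne_zero hP.1)),
      multiplicity_self]
    push_cast
    ring
  rw [h2, finsum_mem_add_distrib hfin, ← ncard_ne_zero_degree_lt,
    finsum_mem_eq_finite_toFinset_sum _ hfin, finsum_mem_eq_finite_toFinset_sum _ hfin,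
    Finset.sum_const, nsmul_one, Set.ncard_eq_toFinset_card _ hfin]

theorem tendsto_average_multiplicity {F : Type*} [Field F] [Finite F] {ℓ : F[X]}
    (hℓ : Irreducible ℓ) :
    Tendsto (fun N : ℕ =>
        (∑ᶠ P ∈ {P : F[X] | P ≠ 0 ∧ P.degree ≤ (N : WithBot ℕ)}, (multiplicity ℓ P : ℝ)) /
          (({P : F[X] | P ≠ 0 ∧ P.degree ≤ (N : WithBot ℕ)}).ncard : ℝ))
      atTop (nhds (1 / ((Nat.card F : ℝ) ^ ℓ.natDegree - 1))) := by
  simp_rw [degree_le_natCast_iff_lt_succ]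
  suffices h : Tendsto (fun n : ℕ =>
        (∑ᶠ P ∈ {P : F[X] | P ≠ 0 ∧ P.degree < n}, (multiplicity ℓ P : ℝ)) /
          (({P : F[X] | P ≠ 0 ∧ P.degree < n}).ncard : ℝ))
      atTop (nhds (1 / ((Nat.card F : ℝ) ^ ℓ.natDegree - 1))) from
    h.comp (tendsto_add_atTop_nat 1)
  simp_rw [ncard_ne_zero_degree_lt]
  have hrec := finsum_multiplicity_recurrence hℓ
  set S : ℕ → ℝ := fun n => ∑ᶠ P ∈ {P : F[X] | P ≠ 0 ∧ P.degree < n}, (multiplicity ℓ P : ℝ)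
  set m := ℓ.natDegree
  have hm : 0 < m := hℓ.natDegree_pos
  set q : ℝ := (Nat.card F : ℝ)
  have hq : 1 < q := by
    simp only [q]
    exact_mod_cast Finite.one_lt_card
  have hq0 : 0 < q := by linarith
  have hr1 : q⁻¹ < 1 := inv_lt_one_of_one_lt₀ hq
  have hr0 : 0 ≤ q⁻¹ := by positivity
  have hm0 : (m : ℝ) ≠ 0 := by exact_mod_cast hm.ne'
  have hQ : 1 < q ^ m := one_lt_pow₀ hq hm.ne'
  have h1 := tendsto_of_affine_recurrence hm (r := (q ^ m)⁻¹) (s := (q ^ m)⁻¹)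
    (e := fun n => (S n + n / m) / q ^ n) (by positivity) (inv_lt_one_of_one_lt₀ hQ) (by
      intro k
      rw [show S (k + m) = S k + (q ^ k - 1) from hrec k, pow_add]
      push_cast
      field_simp
      ring)
  have h2 := (tendsto_self_mul_const_pow_of_lt_one hr0 hr1).div_const (m : ℝ)
  have h3 := (tendsto_const_nhds (x := (1 : ℝ))).sub (tendsto_pow_atTop_nhds_zero_of_lt_one hr0 hr1)
  have h4 := (h1.sub h2).div h3 (by simp)
  have hlim : ((q ^ m)⁻¹ / (1 - (q ^ m)⁻¹) - 0 / (m : ℝ)) / (1 - 0) = 1 / (q ^ m - 1) := by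
    have : q ^ m - 1 ≠ 0 := by linarith
    have h : 1 - (q ^ m)⁻¹ = (q ^ m - 1) / q ^ m := by field_simp
    rw [h]
    field_simp
    simp
  rw [hlim] at h4
  refine h4.congr fun n => ?_
  simp only [Pi.div_apply, inv_pow]
  rw [← mul_div_mul_right _ (1 - (q ^ n)⁻¹) (pow_ne_zero n hq0.ne')]
  congr 1
  · field_simp
    ring
  · field_simp

theorem degree_monic_mul_lt_iff {F : Type*} [Field F] {D a : F[X]} (hD : D.Monic) {n : ℕ}
    (h : D.natDegree < n) :
    (D * a).degree < n ↔ a.degree < ((n - D.natDegree : ℕ) : WithBot ℕ) := by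
  by_cases ha : a = 0
  · simp [ha]
  · rw [← natDegree_lt_iff_degree_lt (mul_ne_zero hD.ne_zero ha), hD.natDegree_mul' ha,
      ← natDegree_lt_iff_degree_lt ha]
    omega

theorem finite_pairs_degree_lt (F : Type*) [Field F] [Finite F] (n : ℕ) :
    {ab : F[X] × F[X] | ab.1.degree < n ∧ ab.2.degree < n}.Finite :=
  (finite_setOf_degree_lt F n).prod (finite_setOf_degree_lt F n)

theorem exists_monic_mul_isCoprime {F : Type*} [Field F] {ab : F[X] × F[X]} (h : ab ≠ 0) :
    ∃ D a b : F[X], D.Monic ∧ IsCoprime a b ∧ ab = (D * a, D * b) := by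
  classical
  obtain ⟨a, b⟩ := ab
  have hg : EuclideanDomain.gcd a b ≠ 0 := by
    rw [Ne, EuclideanDomain.gcd_eq_zero_iff]
    simpa using h
  set g := EuclideanDomain.gcd a b with hg'
  obtain ⟨a', ha⟩ := EuclideanDomain.gcd_dvd_left a b
  obtain ⟨b', hb⟩ := EuclideanDomain.gcd_dvd_right a b
  rw [← hg'] at ha hb
  have hcop : IsCoprime a' b' := by
    refine ⟨EuclideanDomain.gcdA a b, EuclideanDomain.gcdB a b, mul_left_cancel₀ hg ?_⟩
    have := EuclideanDomain.gcd_eq_gcd_ab a b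
    rw [← hg'] at this
    linear_combination (-1 : F[X]) * this - EuclideanDomain.gcdA a b * ha
      - EuclideanDomain.gcdB a b * hb
  obtain ⟨u, hu⟩ := (normalize_associated g).symm
  refine ⟨normalize g, ↑u⁻¹ * a', ↑u⁻¹ * b', monic_normalize hg, ?_, ?_⟩
  · exact (isCoprime_mul_unit_left u⁻¹.isUnit a' b').2 hcop
  · rw [← hu, Prod.mk.injEq, mul_assoc, mul_assoc, Units.mul_inv_cancel_left,
      Units.mul_inv_cancel_left]
    exact ⟨ha, hb⟩

theorem monic_mul_isCoprime_injective {F : Type*} [Field F] {D D' a a' b b' : F[X]}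
    (hD : D.Monic) (hD' : D'.Monic) (h : IsCoprime a b) (h' : IsCoprime a' b')
    (h1 : D * a = D' * a') (h2 : D * b = D' * b') : D = D' ∧ a = a' ∧ b = b' := by
  obtain ⟨x, y, hxy⟩ := h
  obtain ⟨x', y', hxy'⟩ := h'
  have hDD : D = D' := by
    refine eq_of_monic_of_associated hD hD' (associated_of_dvd_dvd ?_ ?_)
    · exact ⟨x' * a + y' * b, by linear_combination (-D') * hxy' - x' * h1 - y' * h2⟩
    · exact ⟨x * a' + y * b', by linear_combination (-D) * hxy + x * h1 + y * h2⟩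
  subst hDD
  exact ⟨rfl, mul_left_cancel₀ hD.ne_zero h1, mul_left_cancel₀ hD.ne_zero h2⟩

theorem ncard_pairs_eq_sum {F : Type*} [Field F] [Finite F] (S c : F[X] × F[X] → Prop)
    (w : F[X] → Prop)
    (h : ∀ D a b, D.Monic → IsCoprime a b → (S (D * a, D * b) ↔ w D ∧ c (a, b))) (n : ℕ) :
    {ab : F[X] × F[X] | ab ≠ 0 ∧ S ab ∧ ab.1.degree < n ∧ ab.2.degree < n}.ncard =
      ∑ j ∈ Finset.range n, {D : F[X] | D.Monic ∧ D.natDegree = j ∧ w D}.ncard *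
        {ab : F[X] × F[X] | IsCoprime ab.1 ab.2 ∧ c ab ∧ ab.1.degree < ((n - j : ℕ) : WithBot ℕ) ∧
          ab.2.degree < ((n - j : ℕ) : WithBot ℕ)}.ncard := by
  set A : ℕ → Set F[X] := fun j => {D : F[X] | D.Monic ∧ D.natDegree = j ∧ w D}
  set B : ℕ → Set (F[X] × F[X]) := fun k =>
    {ab : F[X] × F[X] | IsCoprime ab.1 ab.2 ∧ c ab ∧ ab.1.degree < k ∧ ab.2.degree < k}
  have hAfin : ∀ j, Finite (A j) := fun j =>
    ((finite_setOf_natDegree_eq F j).subset fun D hD => hD.2.1).to_subtype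
  have hBfin : ∀ k, Finite (B k) := fun k =>
    ((finite_pairs_degree_lt F k).subset fun D hD => hD.2.2).to_subtype
  change _ = ∑ j ∈ Finset.range n, (A j).ncard * (B (n - j)).ncard
  simp_rw [Finset.sum_range, ← Nat.card_coe_set_eq, ← Nat.card_prod]
  rw [← Nat.card_sigma (β := fun j : Fin n => A j × B (n - j))]
  symm
  let φ : (Σ j : Fin n, A j × B (n - j)) →
      {ab : F[X] × F[X] | ab ≠ 0 ∧ S ab ∧ ab.1.degree < n ∧ ab.2.degree < n} := fun x =>
    ⟨(x.2.1.1 * x.2.2.1.1, x.2.1.1 * x.2.2.1.2), by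
      obtain ⟨j, ⟨D, hD, hj, hw⟩, ⟨⟨a, b⟩, hcop, hc, ha, hb⟩⟩ := x
      have hlt : D.natDegree < n := hj ▸ j.2
      have ha' : a.degree < ((n - D.natDegree : ℕ) : WithBot ℕ) := by rw [hj]; exact ha
      have hb' : b.degree < ((n - D.natDegree : ℕ) : WithBot ℕ) := by rw [hj]; exact hb
      refine ⟨?_, (h D a b hD hcop).2 ⟨hw, hc⟩, ?_, ?_⟩
      · intro h0
        rw [Prod.mk_eq_zero] at h0
        have ha0 := (mul_eq_zero.1 h0.1).resolve_left hD.ne_zero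
        have hb0 := (mul_eq_zero.1 h0.2).resolve_left hD.ne_zero
        simp only at ha0 hb0 hcop
        rw [ha0, hb0] at hcop
        exact not_isCoprime_zero_zero hcop
      · exact (degree_monic_mul_lt_iff hD hlt).2 ha'
      · exact (degree_monic_mul_lt_iff hD hlt).2 hb'⟩
  refine Nat.card_congr (Equiv.ofBijective φ ⟨?_, ?_⟩)
  · rintro ⟨j, ⟨D, hD, hj, hw⟩, ⟨⟨a, b⟩, hcop, hc, ha, hb⟩⟩
      ⟨j', ⟨D', hD', hj', hw'⟩, ⟨⟨a', b'⟩, hcop', hc', ha', hb'⟩⟩ heq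
    have heq2 := congrArg Subtype.val heq
    simp only [φ, Prod.mk.injEq] at heq2
    obtain ⟨rfl, rfl, rfl⟩ := monic_mul_isCoprime_injective hD hD' hcop hcop' heq2.1 heq2.2
    obtain rfl : j = j' := Fin.ext (hj.symm.trans hj')
    rfl
  · rintro ⟨ab, h0, hS, ha, hb⟩
    obtain ⟨D, a, b, hD, hcop, rfl⟩ := exists_monic_mul_isCoprime h0
    have hlt : D.natDegree < n := by
      rcases hcop.ne_zero_or_ne_zero with h1 | h1
      · have h2 := (natDegree_lt_iff_degree_lt (mul_ne_zero hD.ne_zero h1)).2 ha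
        rw [hD.natDegree_mul' h1] at h2
        omega
      · have h2 := (natDegree_lt_iff_degree_lt (mul_ne_zero hD.ne_zero h1)).2 hb
        rw [hD.natDegree_mul' h1] at h2
        omega
    have hwc := (h D a b hD hcop).1 hS
    exact ⟨⟨⟨D.natDegree, hlt⟩, ⟨D, hD, rfl, hwc.1⟩, ⟨(a, b), hcop, hwc.2,
      (degree_monic_mul_lt_iff hD hlt).1 ha, (degree_monic_mul_lt_iff hD hlt).1 hb⟩⟩, rfl⟩

theorem ncard_monic_natDegree_eq (F : Type*) [Field F] [Finite F] (n : ℕ) :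
    {D : F[X] | D.Monic ∧ D.natDegree = n}.ncard = Nat.card F ^ n := by
  rw [← Nat.card_coe_set_eq, ← ncard_setOf_degree_lt]
  have h : {P : F[X] | P.degree < n} = ((degreeLT F n : Submodule F F[X]) : Set F[X]) := by
    ext P
    simp [mem_degreeLT]
  rw [h, ← Nat.card_coe_set_eq]
  exact Nat.card_congr (monicEquivDegreeLT n)

theorem ncard_monic_natDegree_eq_not_dvd {F : Type*} [Field F] [Finite F] {ℓ : F[X]}
    (hℓ : ℓ.Monic) (n : ℕ) :
    ({D : F[X] | D.Monic ∧ D.natDegree = n ∧ ¬ ℓ ∣ D}.ncard : ℝ) = (Nat.card F : ℝ) ^ n -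
      if ℓ.natDegree ≤ n then (Nat.card F : ℝ) ^ (n - ℓ.natDegree) else 0 := by
  have h : {D : F[X] | D.Monic ∧ D.natDegree = n ∧ ¬ ℓ ∣ D} =
      {D : F[X] | D.Monic ∧ D.natDegree = n} \ {D : F[X] | D.Monic ∧ D.natDegree = n ∧ ℓ ∣ D} := by
    ext D
    simp only [Set.mem_sdiff, Set.mem_ofPred_eq]
    tauto
  have hsub : {D : F[X] | D.Monic ∧ D.natDegree = n ∧ ℓ ∣ D} ⊆
      {D : F[X] | D.Monic ∧ D.natDegree = n} := fun D hD => ⟨hD.1, hD.2.1⟩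
  rw [h, Set.cast_ncard_sdiff hsub
    ((finite_setOf_natDegree_eq F n).subset fun D hD => hD.2), ncard_monic_natDegree_eq]
  push_cast
  congr 1
  split_ifs with hn
  · rw [← Nat.cast_pow, ← ncard_monic_natDegree_eq,
      ← Set.ncard_image_of_injective {D : F[X] | D.Monic ∧ D.natDegree = n - ℓ.natDegree}
        (mul_right_injective₀ hℓ.ne_zero)]
    congr 2
    ext D
    simp only [Set.mem_ofPred_eq, Set.mem_image]
    constructor
    · rintro ⟨h1, h2, D', rfl⟩
      have h3 : D'.Monic := hℓ.of_mul_monic_left h1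
      rw [hℓ.natDegree_mul h3] at h2
      exact ⟨D', ⟨h3, by omega⟩, rfl⟩
    · rintro ⟨D', ⟨h1, h2⟩, rfl⟩
      refine ⟨hℓ.mul h1, ?_, dvd_mul_right _ _⟩
      rw [hℓ.natDegree_mul h1]
      omega
  · rw [Nat.cast_eq_zero, Set.ncard_eq_zero
      ((finite_setOf_natDegree_eq F n).subset fun D hD => hD.2.1)]
    refine Set.eq_empty_of_forall_notMem ?_
    rintro D ⟨h1, h2, h3⟩
    exact hn (h2 ▸ natDegree_le_of_dvd h3 h1.ne_zero)

theorem sub_mul_convolution_succ (u E : ℕ → ℝ) (q : ℝ) (n : ℕ) :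
    (∑ j ∈ Finset.range (n + 1), u j * E (n + 1 - j)) - q * ∑ j ∈ Finset.range n, u j * E (n - j)
      = u 0 * E (n + 1) + ∑ j ∈ Finset.range n, (u (j + 1) - q * u j) * E (n - j) := by
  rw [Finset.sum_range_succ', Finset.mul_sum]
  simp only [Nat.add_sub_add_right, Nat.sub_zero, sub_mul, Finset.sum_sub_distrib, mul_assoc]
  ring

theorem ncard_pairs_degree_lt (F : Type*) [Field F] [Finite F] (n : ℕ) :
    {ab : F[X] × F[X] | ab.1.degree < n ∧ ab.2.degree < n}.ncard = Nat.card F ^ (2 * n) := by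
  have h : {ab : F[X] × F[X] | ab.1.degree < n ∧ ab.2.degree < n} =
    {P : F[X] | P.degree < n} ×ˢ {P : F[X] | P.degree < n} := rfl
  rw [h, Set.ncard_prod, ncard_setOf_degree_lt, two_mul, pow_add]

theorem ncard_isCoprime_pairs (F : Type*) [Field F] [Finite F] (n : ℕ) :
    ({ab : F[X] × F[X] | IsCoprime ab.1 ab.2 ∧ ab.1.degree < ((n + 1 : ℕ) : WithBot ℕ) ∧
      ab.2.degree < ((n + 1 : ℕ) : WithBot ℕ)}.ncard : ℝ) =
      (Nat.card F : ℝ) ^ (2 * n + 2) - (Nat.card F : ℝ) ^ (2 * n + 1) + Nat.card F - 1 := by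
  have h := ncard_pairs_eq_sum (F := F) (fun _ => True) (fun _ => True) (fun _ => True)
    (fun _ _ _ _ _ => by simp)
  simp only [true_and, and_true, ncard_monic_natDegree_eq] at h
  have hP : ∀ k : ℕ, ({ab : F[X] × F[X] | ab ≠ 0 ∧ ab.1.degree < k ∧ ab.2.degree < k}.ncard : ℝ)
      = (Nat.card F : ℝ) ^ (2 * k) - 1 := by
    intro k
    have h1 : {ab : F[X] × F[X] | ab ≠ 0 ∧ ab.1.degree < k ∧ ab.2.degree < k} =
        {ab : F[X] × F[X] | ab.1.degree < k ∧ ab.2.degree < k} \ {0} := by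
      ext ab
      simp [and_comm]
    rw [h1, Set.cast_ncard_sdiff (by simp) (finite_pairs_degree_lt F k),
      ncard_pairs_degree_lt]
    simp
  have h2 := sub_mul_convolution_succ (fun j => (Nat.card F : ℝ) ^ j)
    (fun k => ({ab : F[X] × F[X] | IsCoprime ab.1 ab.2 ∧ ab.1.degree < k ∧
      ab.2.degree < k}.ncard : ℝ)) (Nat.card F) n
  have h3 : ∀ k : ℕ, ∑ j ∈ Finset.range k, (Nat.card F : ℝ) ^ j *
      ({ab : F[X] × F[X] | IsCoprime ab.1 ab.2 ∧ ab.1.degree < ((k - j : ℕ) : WithBot ℕ) ∧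
        ab.2.degree < ((k - j : ℕ) : WithBot ℕ)}.ncard : ℝ) = (Nat.card F : ℝ) ^ (2 * k) - 1 := by
    intro k
    rw [← hP, h k]
    push_cast
    rfl
  rw [h3, h3] at h2
  simp only [pow_succ, mul_comm, sub_self, zero_mul, Finset.sum_const_zero] at h2 ⊢
  linear_combination -h2

theorem ncard_pairs_dvd_form {F : Type*} [Field F] [Finite F] (p e : ℕ) [Fact p.Prime] [CharP F p]
    {f₀ f₁ ℓ : F[X]} (hcop : IsCoprime f₁ f₀) (hℓ : Irreducible ℓ) {n : ℕ}
    (hn : ℓ.natDegree ≤ n) :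
    {ab : F[X] × F[X] | ℓ ∣ f₁ * ab.1 ^ p ^ e + f₀ * ab.2 ^ p ^ e ∧
      ab.1.degree < n ∧ ab.2.degree < n}.ncard * Nat.card F ^ ℓ.natDegree =
        Nat.card F ^ (2 * n) := by
  have := Fact.mk hℓ
  let K := AdjoinRoot ℓ
  have hKfin : Module.Finite F K := (AdjoinRoot.powerBasis hℓ.ne_zero).finite
  have : Finite K := Module.finite_of_finite F
  have hKcard : Nat.card K = Nat.card F ^ ℓ.natDegree := by
    rw [Module.natCard_eq_pow_finrank (K := F), (AdjoinRoot.powerBasis hℓ.ne_zero).finrank,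
      AdjoinRoot.powerBasis_dim]
  have : CharP K p := charP_of_injective_algebraMap (algebraMap F K).injective p
  let frob : K ≃+* K := iterateFrobeniusEquiv K p e
  have hfrob : ∀ x, frob x = x ^ p ^ e := fun x => iterateFrobeniusEquiv_def K p e x
  let ψ : F[X] × F[X] →+ K := AddMonoidHom.mk'
    (fun ab => AdjoinRoot.mk ℓ f₁ * frob (AdjoinRoot.mk ℓ ab.1)
      + AdjoinRoot.mk ℓ f₀ * frob (AdjoinRoot.mk ℓ ab.2)) (fun x y => by
        simp only [Prod.fst_add, Prod.snd_add, map_add]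
        ring)
  have hψ : ∀ ab, ψ ab = AdjoinRoot.mk ℓ (f₁ * ab.1 ^ p ^ e + f₀ * ab.2 ^ p ^ e) := fun ab => by
    simp [ψ, hfrob]
  let G : AddSubgroup (F[X] × F[X]) :=
    (degreeLT F n).toAddSubgroup.prod (degreeLT F n).toAddSubgroup
  have hG : ∀ ab, ab ∈ G ↔ ab.1.degree < n ∧ ab.2.degree < n := fun ab => by
    simp [G, AddSubgroup.mem_prod, mem_degreeLT]
  have hlift : ∀ x : K, ∃ a : F[X], a.degree < n ∧ AdjoinRoot.mk ℓ a = x := by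
    intro x
    obtain ⟨P, rfl⟩ := AdjoinRoot.mk_surjective x
    refine ⟨P % ℓ, (degree_mod_lt P hℓ.ne_zero).trans_le ?_, ?_⟩
    · exact degree_le_natDegree.trans (by exact_mod_cast hn)
    · rw [AdjoinRoot.mk_eq_mk]
      exact ⟨-(P / ℓ), by linear_combination (EuclideanDomain.div_add_mod P ℓ)⟩
  let φ : G →+ K := ψ.comp G.subtype
  have hsurj : Function.Surjective φ := by
    intro y
    have hne : AdjoinRoot.mk ℓ f₁ ≠ 0 ∨ AdjoinRoot.mk ℓ f₀ ≠ 0 :=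
      (hcop.map (AdjoinRoot.mk ℓ)).ne_zero_or_ne_zero
    rcases hne with hne | hne
    · obtain ⟨a, ha, hax⟩ := hlift (frob.symm (y / AdjoinRoot.mk ℓ f₁))
      refine ⟨⟨(a, 0), (hG _).2 ⟨ha, by simp⟩⟩, ?_⟩
      change AdjoinRoot.mk ℓ f₁ * frob (AdjoinRoot.mk ℓ a)
        + AdjoinRoot.mk ℓ f₀ * frob (AdjoinRoot.mk ℓ 0) = y
      rw [hax, RingEquiv.apply_symm_apply, map_zero, map_zero, mul_zero, add_zero,
        mul_div_cancel₀ _ hne]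
    · obtain ⟨a, ha, hax⟩ := hlift (frob.symm (y / AdjoinRoot.mk ℓ f₀))
      refine ⟨⟨(0, a), (hG _).2 ⟨by simp, ha⟩⟩, ?_⟩
      change AdjoinRoot.mk ℓ f₁ * frob (AdjoinRoot.mk ℓ 0)
        + AdjoinRoot.mk ℓ f₀ * frob (AdjoinRoot.mk ℓ a) = y
      rw [hax, RingEquiv.apply_symm_apply, map_zero, map_zero, mul_zero, zero_add,
        mul_div_cancel₀ _ hne]
  have hcount := φ.ker.card_mul_index
  rw [AddSubgroup.index_ker, AddMonoidHom.range_eq_top.2 hsurj, AddSubgroup.card_top, hKcard]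
    at hcount
  have hGcard : Nat.card G = Nat.card F ^ (2 * n) := by
    rw [← ncard_pairs_degree_lt, ← Nat.card_coe_set_eq]
    exact Nat.card_congr (Equiv.subtypeEquivRight hG)
  rw [hGcard] at hcount
  rw [← hcount]
  congr 1
  change _ = Nat.card ((φ.ker : Set G))
  rw [Nat.card_coe_set_eq, ← Set.ncard_image_of_injective _ Subtype.val_injective]
  congr 1
  ext ab
  simp only [Set.mem_ofPred_eq, Set.mem_image, SetLike.mem_coe, AddMonoidHom.mem_ker]
  have hker : ∀ x : G, φ x = 0 ↔ ℓ ∣ f₁ * x.1.1 ^ p ^ e + f₀ * x.1.2 ^ p ^ e := fun x => by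
    change ψ x.1 = 0 ↔ _
    rw [hψ, AdjoinRoot.mk_eq_zero]
  constructor
  · rintro ⟨h1, h2⟩
    exact ⟨⟨ab, (hG ab).2 h2⟩, (hker _).2 h1, rfl⟩
  · rintro ⟨x, h1, rfl⟩
    exact ⟨(hker x).1 h1, (hG _).1 x.2⟩

theorem ncard_pairs_both_dvd {F : Type*} [Field F] [Finite F] {ℓ : F[X]} (hℓ : ℓ.Monic) (k : ℕ) :
    {ab : F[X] × F[X] | (ℓ ∣ ab.1 ∧ ℓ ∣ ab.2) ∧ ab.1.degree < ((k + ℓ.natDegree : ℕ) : WithBot ℕ) ∧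
      ab.2.degree < ((k + ℓ.natDegree : ℕ) : WithBot ℕ)}.ncard = Nat.card F ^ (2 * k) := by
  have hinj : Function.Injective fun ab : F[X] × F[X] => (ℓ * ab.1, ℓ * ab.2) := by
    intro x y h
    rw [Prod.mk.injEq] at h
    exact Prod.ext (mul_left_cancel₀ hℓ.ne_zero h.1) (mul_left_cancel₀ hℓ.ne_zero h.2)
  have hdeg : ∀ a : F[X],
      (ℓ * a).degree < ((k + ℓ.natDegree : ℕ) : WithBot ℕ) ↔ a.degree < k := by
    intro a
    by_cases ha : a = 0
    · simp [ha]
    · rw [← natDegree_lt_iff_degree_lt (mul_ne_zero hℓ.ne_zero ha), hℓ.natDegree_mul' ha,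
        ← natDegree_lt_iff_degree_lt ha]
      omega
  rw [← ncard_pairs_degree_lt, ← Set.ncard_image_of_injective
    {ab : F[X] × F[X] | ab.1.degree < k ∧ ab.2.degree < k} hinj]
  congr 1
  ext ⟨x, y⟩
  simp only [Set.mem_ofPred_eq, Set.mem_image, Prod.mk.injEq]
  constructor
  · rintro ⟨⟨⟨a, rfl⟩, b, rfl⟩, h1, h2⟩
    exact ⟨(a, b), ⟨(hdeg a).1 h1, (hdeg b).1 h2⟩, rfl, rfl⟩
  · rintro ⟨⟨a, b⟩, ⟨h1, h2⟩, rfl, rfl⟩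
    exact ⟨⟨dvd_mul_right _ _, dvd_mul_right _ _⟩, (hdeg a).2 h1, (hdeg b).2 h2⟩

theorem ncard_isCoprime_dvd_form_recurrence {F : Type*} [Field F] [Finite F] (p e : ℕ)
    [Fact p.Prime] [CharP F p] {f₀ f₁ ℓ : F[X]} (hcop : IsCoprime f₁ f₀) (hℓ : Irreducible ℓ)
    (hmonic : ℓ.Monic) (k : ℕ) :
    ({ab : F[X] × F[X] | IsCoprime ab.1 ab.2 ∧ ℓ ∣ f₁ * ab.1 ^ p ^ e + f₀ * ab.2 ^ p ^ e ∧
      ab.1.degree < ((k + ℓ.natDegree + 1 : ℕ) : WithBot ℕ) ∧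
      ab.2.degree < ((k + ℓ.natDegree + 1 : ℕ) : WithBot ℕ)}.ncard : ℝ) =
    {ab : F[X] × F[X] | IsCoprime ab.1 ab.2 ∧ ℓ ∣ f₁ * ab.1 ^ p ^ e + f₀ * ab.2 ^ p ^ e ∧
      ab.1.degree < ((k + 1 : ℕ) : WithBot ℕ) ∧ ab.2.degree < ((k + 1 : ℕ) : WithBot ℕ)}.ncard +
    (Nat.card F : ℝ) ^ (2 * k + 1) * (Nat.card F - 1) *
      ((Nat.card F : ℝ) ^ ℓ.natDegree - 1) := by
  have hp0 : p ^ e ≠ 0 := pow_ne_zero _ (Fact.out : p.Prime).ne_zero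
  have hq0 : (Nat.card F : ℝ) ≠ 0 := by exact_mod_cast Nat.card_pos.ne'
  have hm : 0 < ℓ.natDegree := hℓ.natDegree_pos
  set c : F[X] × F[X] → Prop := fun ab => ℓ ∣ f₁ * ab.1 ^ p ^ e + f₀ * ab.2 ^ p ^ e with hc
  have hboth : ∀ a b : F[X], ℓ ∣ a → ℓ ∣ b → c (a, b) := fun a b ha hb =>
    dvd_add (dvd_mul_of_dvd_right (dvd_pow ha hp0) _) (dvd_mul_of_dvd_right (dvd_pow hb hp0) _)
  have hsum := ncard_pairs_eq_sum (F := F) (fun ab => ¬ (ℓ ∣ ab.1 ∧ ℓ ∣ ab.2) ∧ c ab) c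
    (fun D => ¬ ℓ ∣ D) (by
      intro D a b hD hab
      have hcD : c (D * a, D * b) ↔ ℓ ∣ D ∨ c (a, b) := by
        have : f₁ * (D * a) ^ p ^ e + f₀ * (D * b) ^ p ^ e =
            D ^ p ^ e * (f₁ * a ^ p ^ e + f₀ * b ^ p ^ e) := by ring
        simp only [hc]
        rw [this, hℓ.prime.dvd_mul, hℓ.prime.dvd_pow_iff_dvd hp0]
      have hnot : ¬ (ℓ ∣ a ∧ ℓ ∣ b) := fun h => hℓ.not_isUnit (hab.isUnit_of_dvd' h.1 h.2)
      simp only [hcD, hℓ.prime.dvd_mul]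
      tauto)
  set E : ℕ → ℝ := fun n => ({ab : F[X] × F[X] | IsCoprime ab.1 ab.2 ∧ c ab ∧
    ab.1.degree < n ∧ ab.2.degree < n}.ncard : ℝ) with hE
  set u : ℕ → ℝ := fun j => ({D : F[X] | D.Monic ∧ D.natDegree = j ∧ ¬ ℓ ∣ D}.ncard : ℝ) with hu
  have hu' : ∀ j, u j = _ := ncard_monic_natDegree_eq_not_dvd hmonic
  set q : ℝ := (Nat.card F : ℝ) with hq
  have hT : ∀ k : ℕ, ∑ j ∈ Finset.range (k + ℓ.natDegree), u j * E (k + ℓ.natDegree - j) =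
      q ^ (2 * k + ℓ.natDegree) - q ^ (2 * k) := by
    intro k
    have h1 := hsum (k + ℓ.natDegree)
    have h2 : {ab : F[X] × F[X] | ab ≠ 0 ∧ (¬ (ℓ ∣ ab.1 ∧ ℓ ∣ ab.2) ∧ c ab) ∧
        ab.1.degree < ((k + ℓ.natDegree : ℕ) : WithBot ℕ) ∧
        ab.2.degree < ((k + ℓ.natDegree : ℕ) : WithBot ℕ)} =
      {ab : F[X] × F[X] | c ab ∧ ab.1.degree < ((k + ℓ.natDegree : ℕ) : WithBot ℕ) ∧
        ab.2.degree < ((k + ℓ.natDegree : ℕ) : WithBot ℕ)} \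
      {ab : F[X] × F[X] | (ℓ ∣ ab.1 ∧ ℓ ∣ ab.2) ∧
        ab.1.degree < ((k + ℓ.natDegree : ℕ) : WithBot ℕ) ∧
        ab.2.degree < ((k + ℓ.natDegree : ℕ) : WithBot ℕ)} := by
      ext ab
      have h0 : ¬ (ℓ ∣ ab.1 ∧ ℓ ∣ ab.2) → ab ≠ 0 := by
        rintro h rfl
        exact h ⟨dvd_zero _, dvd_zero _⟩
      simp only [Set.mem_ofPred_eq, Set.mem_sdiff]
      tauto
    have hsub : {ab : F[X] × F[X] | (ℓ ∣ ab.1 ∧ ℓ ∣ ab.2) ∧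
        ab.1.degree < ((k + ℓ.natDegree : ℕ) : WithBot ℕ) ∧
        ab.2.degree < ((k + ℓ.natDegree : ℕ) : WithBot ℕ)} ⊆
      {ab : F[X] × F[X] | c ab ∧ ab.1.degree < ((k + ℓ.natDegree : ℕ) : WithBot ℕ) ∧
        ab.2.degree < ((k + ℓ.natDegree : ℕ) : WithBot ℕ)} :=
      fun ab h => ⟨hboth _ _ h.1.1 h.1.2, h.2⟩
    have h3 := congrArg (Nat.cast (R := ℝ)) h1
    rw [h2, Set.cast_ncard_sdiff hsub ((finite_pairs_degree_lt F _).subset fun ab h => h.2),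
      ncard_pairs_both_dvd hmonic] at h3
    have h4 := congrArg (Nat.cast (R := ℝ))
      (ncard_pairs_dvd_form p e hcop hℓ (Nat.le_add_left ℓ.natDegree k))
    push_cast at h3 h4
    rw [← hq] at h3 h4
    rw [mul_add, two_mul ℓ.natDegree, ← add_assoc, pow_add _ (2 * k + ℓ.natDegree)] at h4
    have h5 := mul_right_cancel₀ (pow_ne_zero _ hq0) h4
    rw [h5] at h3
    exact h3.symm
  have hrec := sub_mul_convolution_succ u E q (k + ℓ.natDegree)
  have hT1 := hT (k + 1)
  rw [add_right_comm] at hT1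
  rw [hT, hT1] at hrec
  have hu0 : u 0 = 1 := by simp [hu', hm.ne']
  have hdiff : ∀ j, u (j + 1) - q * u j = if j = ℓ.natDegree - 1 then -1 else 0 := by
    intro j
    rw [hu', hu']
    rcases lt_trichotomy (j + 1) ℓ.natDegree with h | h | h
    · rw [if_neg (by omega), if_neg (by omega), if_neg (by omega)]
      ring
    · rw [if_pos (by omega), if_neg (by omega), if_pos (by omega), h]
      rw [← h]
      simp
      ring
    · rw [if_pos (by omega), if_pos (by omega), if_neg (by omega),
        show j + 1 - ℓ.natDegree = (j - ℓ.natDegree) + 1 by omega]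
      ring
  simp_rw [hdiff, ite_mul, zero_mul] at hrec
  rw [Finset.sum_ite_eq' (Finset.range (k + ℓ.natDegree)) (ℓ.natDegree - 1),
    if_pos (Finset.mem_range.2 (by omega)), hu0,
    show k + ℓ.natDegree - (ℓ.natDegree - 1) = k + 1 by omega] at hrec
  change E (k + ℓ.natDegree + 1) = E (k + 1) + _
  linear_combination -hrec

theorem tendsto_ncard_dvd_form_div {F : Type*} [Field F] [Finite F] (p e : ℕ)
    [Fact p.Prime] [CharP F p] {f₀ f₁ ℓ : F[X]} (hcop : IsCoprime f₁ f₀) (hℓ : Irreducible ℓ)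
    (hmonic : ℓ.Monic) :
    Tendsto (fun N : ℕ =>
      ({ab : F[X] × F[X] | IsCoprime ab.1 ab.2 ∧ ℓ ∣ f₁ * ab.1 ^ p ^ e + f₀ * ab.2 ^ p ^ e ∧
        ab.1.degree ≤ (N : WithBot ℕ) ∧ ab.2.degree ≤ (N : WithBot ℕ)}.ncard : ℝ) /
      ({ab : F[X] × F[X] | IsCoprime ab.1 ab.2 ∧
        ab.1.degree ≤ (N : WithBot ℕ) ∧ ab.2.degree ≤ (N : WithBot ℕ)}.ncard : ℝ))
      atTop (nhds (1 / ((Nat.card F : ℝ) ^ ℓ.natDegree + 1))) := by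
  simp_rw [degree_le_natCast_iff_lt_succ, ncard_isCoprime_pairs]
  have hrec := ncard_isCoprime_dvd_form_recurrence p e hcop hℓ hmonic
  set m := ℓ.natDegree with hm'
  have hm : 0 < m := hℓ.natDegree_pos
  set E : ℕ → ℝ := fun N => ({ab : F[X] × F[X] | IsCoprime ab.1 ab.2 ∧
    ℓ ∣ f₁ * ab.1 ^ p ^ e + f₀ * ab.2 ^ p ^ e ∧
    ab.1.degree < ((N + 1 : ℕ) : WithBot ℕ) ∧ ab.2.degree < ((N + 1 : ℕ) : WithBot ℕ)}.ncard : ℝ)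
  set q : ℝ := (Nat.card F : ℝ)
  have hq : 1 < q := by
    simp only [q]
    exact_mod_cast Finite.one_lt_card
  have hq0 : 0 < q := by linarith
  have hQ : 1 < q ^ m := one_lt_pow₀ hq hm.ne'
  have hQ2 : 1 < (q ^ m) ^ 2 := one_lt_pow₀ hQ two_ne_zero
  have h1 := tendsto_of_affine_recurrence hm (r := ((q ^ m) ^ 2)⁻¹)
    (s := (q - 1) * (q ^ m - 1) / (q * (q ^ m) ^ 2)) (e := fun k => E k / q ^ (2 * k + 2))
    (by positivity) (inv_lt_one_of_one_lt₀ hQ2) (by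
      intro k
      rw [show E (k + m) = E k + q ^ (2 * k + 1) * (q - 1) * (q ^ m - 1) from hrec k]
      rw [show 2 * (k + m) + 2 = 2 * k + 1 + 1 + m * 2 by ring, show 2 * k + 2 = 2 * k + 1 + 1 by ring,
        pow_add _ (2 * k + 1 + 1), pow_mul q m 2, pow_succ _ (2 * k + 1)]
      field_simp)
  have hr0 : 0 ≤ (q ^ 2)⁻¹ := by positivity
  have hr1 : (q ^ 2)⁻¹ < 1 := inv_lt_one_of_one_lt₀ (one_lt_pow₀ hq two_ne_zero)
  have h2 := (((tendsto_pow_atTop_nhds_zero_of_lt_one hr0 hr1).mul_const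
    ((q - 1) / q ^ 2)).const_add (1 - q⁻¹))
  have hq1 : q - 1 ≠ 0 := by linarith
  have h3 := h1.div h2 (by
    rw [zero_mul, add_zero]
    have : 1 - q⁻¹ = (q - 1) / q := by field_simp
    rw [this]
    positivity)
  have hlim : (q - 1) * (q ^ m - 1) / (q * (q ^ m) ^ 2) / (1 - ((q ^ m) ^ 2)⁻¹) /
      (1 - q⁻¹ + 0 * ((q - 1) / q ^ 2)) = 1 / (q ^ m + 1) := by
    have a1 : 1 - q⁻¹ = (q - 1) / q := by field_simp
    have a2 : 1 - ((q ^ m) ^ 2)⁻¹ = (q ^ m - 1) * (q ^ m + 1) / (q ^ m) ^ 2 := by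
      field_simp
      ring
    have a3 : q ^ m - 1 ≠ 0 := by linarith
    have a4 : q ^ m + 1 ≠ 0 := by linarith
    rw [a1, a2, zero_mul, add_zero]
    field_simp
  rw [hlim] at h3
  refine h3.congr fun N => ?_
  simp only [Pi.div_apply]
  rw [div_div]
  congr 1
  rw [inv_pow, ← pow_mul, pow_add q (2 * N) 2, pow_add q (2 * N) 1]
  field_simp
  ring

theorem not_sq_dvd_form {F : Type*} [Field F] {d : ℕ} {f₀ f₁ ℓ : F[X]}
    (hℓ : Irreducible ℓ) (hmonic : ℓ.Monic)
    (haff : ¬ ∃ r : F[X], r.degree < ((2 * ℓ.natDegree : ℕ) : WithBot ℕ) ∧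
      ℓ ^ 2 ∣ (f₁ * r ^ d + f₀))
    (hproj : ¬ ∃ r : F[X], ℓ ∣ r ∧ r.degree < ((2 * ℓ.natDegree : ℕ) : WithBot ℕ) ∧
      ℓ ^ 2 ∣ (f₁ + f₀ * r ^ d))
    {a b : F[X]} (hab : IsCoprime a b) : ¬ ℓ ^ 2 ∣ f₁ * a ^ d + f₀ * b ^ d := by
  intro hdvd
  have hdeg : ∀ P : F[X], (P % ℓ ^ 2).degree < ((2 * ℓ.natDegree : ℕ) : WithBot ℕ) := fun P => by
    have := degree_mod_lt P (pow_ne_zero 2 hℓ.ne_zero)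
    rwa [degree_eq_natDegree (pow_ne_zero 2 hℓ.ne_zero), hmonic.natDegree_pow] at this
  have hmod : ∀ P : F[X], AdjoinRoot.mk (ℓ ^ 2) (P % ℓ ^ 2) = AdjoinRoot.mk (ℓ ^ 2) P := fun P => by
    rw [AdjoinRoot.mk_eq_mk]
    exact ⟨-(P / ℓ ^ 2), by linear_combination (EuclideanDomain.div_add_mod P (ℓ ^ 2))⟩
  have hinv : ∀ c : F[X], ¬ ℓ ∣ c → ∃ x, AdjoinRoot.mk (ℓ ^ 2) c * AdjoinRoot.mk (ℓ ^ 2) x = 1 := by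
    intro c hc
    obtain ⟨x, y, hxy⟩ := ((hℓ.coprime_iff_not_dvd.2 hc).symm.pow_right (n := 2))
    refine ⟨x, ?_⟩
    rw [← map_mul, ← map_one (AdjoinRoot.mk (ℓ ^ 2)), AdjoinRoot.mk_eq_mk]
    exact ⟨-y, by linear_combination hxy⟩
  rw [← AdjoinRoot.mk_eq_zero] at hdvd
  simp only [map_add, map_mul, map_pow] at hdvd
  by_cases hb : ℓ ∣ b
  · have ha : ¬ ℓ ∣ a := fun ha => hℓ.not_isUnit (hab.isUnit_of_dvd' ha hb)
    obtain ⟨x, hx⟩ := hinv a ha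
    refine hproj ⟨(b * x) % ℓ ^ 2, ?_, hdeg _, ?_⟩
    · rw [EuclideanDomain.dvd_mod_iff (dvd_pow_self ℓ two_ne_zero)]
      exact hb.mul_right x
    · rw [← AdjoinRoot.mk_eq_zero]
      simp only [map_add, map_mul, map_pow, hmod]
      have hxd := congrArg (· ^ d) hx
      simp only [mul_pow, one_pow] at hxd ⊢
      linear_combination AdjoinRoot.mk (ℓ ^ 2) x ^ d * hdvd - AdjoinRoot.mk (ℓ ^ 2) f₁ * hxd
  · obtain ⟨x, hx⟩ := hinv b hb
    refine haff ⟨(a * x) % ℓ ^ 2, hdeg _, ?_⟩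
    rw [← AdjoinRoot.mk_eq_zero]
    simp only [map_add, map_mul, map_pow, hmod]
    have hxd := congrArg (· ^ d) hx
    simp only [mul_pow, one_pow] at hxd ⊢
    linear_combination AdjoinRoot.mk (ℓ ^ 2) x ^ d * hdvd - AdjoinRoot.mk (ℓ ^ 2) f₀ * hxd

/-- Coppersmith polynomials.  Let `q` be a power of the prime
`p = char F_q`, `d` a power of `p`, `f̂ = f̂₁ x + f̂₀` with `f̂₁ ≠ 0` and
`gcd(f̂₁, f̂₀) = 1`, and `f = f̂(x^d) = f̂₁ x^d + f̂₀`, with homogenization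
`F(a,b) = f̂₁ a^d + f̂₀ b^d`.  Assume that for every monic irreducible `ℓ` the polynomial
`f` has no affine root and no projective root modulo `ℓ²`.  Then `α_ℓ(f)` exists for every
monic irreducible `ℓ` and `α(f) = lim_{b₀→∞} Σ_{deg ℓ ≤ b₀} α_ℓ(f) = 2/(q-1)`. -/
theorem alpha_coppersmith
    (Fq : Type*) [Field Fq] [Fintype Fq]
    (p : ℕ) (hp : p.Prime) (hchar : CharP Fq p)
    (d : ℕ) (hd : ∃ e : ℕ, d = p ^ e)
    (f₀ f₁ : Polynomial Fq) (hf₁ : f₁ ≠ 0) (hcop : IsCoprime f₁ f₀)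
    (hnolift : ∀ ℓ : Polynomial Fq, ℓ.Monic → Irreducible ℓ →
      (¬ ∃ r : Polynomial Fq, r.degree < ((2 * ℓ.natDegree : ℕ) : WithBot ℕ) ∧
          ℓ ^ 2 ∣ (f₁ * r ^ d + f₀)) ∧
      (¬ ∃ r : Polynomial Fq, ℓ ∣ r ∧ r.degree < ((2 * ℓ.natDegree : ℕ) : WithBot ℕ) ∧
          ℓ ^ 2 ∣ (f₁ + f₀ * r ^ d))) :
    ∃ αl : Polynomial Fq → ℝ,
      (∀ ℓ : Polynomial Fq, ℓ.Monic → Irreducible ℓ →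
        ∃ A₁ A₂ : ℝ,
          Filter.Tendsto (fun N : ℕ =>
              (∑ᶠ P ∈ {P : Polynomial Fq | P ≠ 0 ∧ P.degree ≤ (N : WithBot ℕ)},
                (multiplicity ℓ P : ℝ)) /
              (({P : Polynomial Fq | P ≠ 0 ∧ P.degree ≤ (N : WithBot ℕ)}).ncard : ℝ))
            Filter.atTop (nhds A₁) ∧
          Filter.Tendsto (fun N : ℕ =>
              (∑ᶠ ab ∈ {ab : Polynomial Fq × Polynomial Fq | IsCoprime ab.1 ab.2 ∧
                  f₁ * ab.1 ^ d + f₀ * ab.2 ^ d ≠ 0 ∧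
                  ab.1.degree ≤ (N : WithBot ℕ) ∧ ab.2.degree ≤ (N : WithBot ℕ)},
                (multiplicity ℓ (f₁ * ab.1 ^ d + f₀ * ab.2 ^ d) : ℝ)) /
              (({ab : Polynomial Fq × Polynomial Fq | IsCoprime ab.1 ab.2 ∧
                  f₁ * ab.1 ^ d + f₀ * ab.2 ^ d ≠ 0 ∧
                  ab.1.degree ≤ (N : WithBot ℕ) ∧ ab.2.degree ≤ (N : WithBot ℕ)}).ncard : ℝ))
            Filter.atTop (nhds A₂) ∧
          αl ℓ = (ℓ.natDegree : ℝ) * (A₁ - A₂)) ∧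
      Filter.Tendsto (fun b₀ : ℕ =>
          ∑ᶠ ℓ ∈ {ℓ : Polynomial Fq | ℓ.Monic ∧ Irreducible ℓ ∧ ℓ.degree ≤ (b₀ : WithBot ℕ)},
            αl ℓ)
        Filter.atTop (nhds (2 / ((Fintype.card Fq : ℝ) - 1))) := by
  obtain ⟨e, rfl⟩ := hd
  have := Fact.mk hp
  have hq : (1 : ℝ) < Nat.card Fq := by exact_mod_cast Finite.one_lt_card
  refine ⟨fun ℓ => (ℓ.natDegree : ℝ) * (1 / ((Nat.card Fq : ℝ) ^ ℓ.natDegree - 1) -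
    1 / ((Nat.card Fq : ℝ) ^ ℓ.natDegree + 1)), ?_, ?_⟩
  · intro ℓ hmonic hℓ
    refine ⟨_, _, tendsto_average_multiplicity hℓ, ?_, rfl⟩
    have hsq : ∀ ab : Fq[X] × Fq[X], IsCoprime ab.1 ab.2 →
        ¬ ℓ ^ 2 ∣ f₁ * ab.1 ^ p ^ e + f₀ * ab.2 ^ p ^ e := fun ab hab =>
      not_sq_dvd_form hℓ hmonic (hnolift ℓ hmonic hℓ).1 (hnolift ℓ hmonic hℓ).2 hab
    refine (tendsto_ncard_dvd_form_div p e hcop hℓ hmonic).congr fun N => ?_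
    have hset : {ab : Fq[X] × Fq[X] | IsCoprime ab.1 ab.2 ∧
        f₁ * ab.1 ^ p ^ e + f₀ * ab.2 ^ p ^ e ≠ 0 ∧
        ab.1.degree ≤ (N : WithBot ℕ) ∧ ab.2.degree ≤ (N : WithBot ℕ)} =
      {ab : Fq[X] × Fq[X] | IsCoprime ab.1 ab.2 ∧
        ab.1.degree ≤ (N : WithBot ℕ) ∧ ab.2.degree ≤ (N : WithBot ℕ)} := by
      ext ab
      exact ⟨fun h => ⟨h.1, h.2.2⟩, fun h => ⟨h.1, fun h0 => hsq ab h.1 (h0 ▸ dvd_zero _), h.2⟩⟩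
    rw [hset]
    congr 1
    have hfin : {ab : Fq[X] × Fq[X] | IsCoprime ab.1 ab.2 ∧
        ℓ ∣ f₁ * ab.1 ^ p ^ e + f₀ * ab.2 ^ p ^ e ∧
        ab.1.degree ≤ (N : WithBot ℕ) ∧ ab.2.degree ≤ (N : WithBot ℕ)}.Finite := by
      simp_rw [degree_le_natCast_iff_lt_succ]
      exact (finite_pairs_degree_lt Fq (N + 1)).subset fun ab h => h.2.2
    rw [Set.ncard_eq_toFinset_card _ hfin, Finset.cast_card,
      ← finsum_mem_eq_finite_toFinset_sum (fun _ => (1 : ℝ)) hfin]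
    trans ∑ᶠ ab ∈ {ab : Fq[X] × Fq[X] | IsCoprime ab.1 ab.2 ∧
        ℓ ∣ f₁ * ab.1 ^ p ^ e + f₀ * ab.2 ^ p ^ e ∧
        ab.1.degree ≤ (N : WithBot ℕ) ∧ ab.2.degree ≤ (N : WithBot ℕ)},
        (multiplicity ℓ (f₁ * ab.1 ^ p ^ e + f₀ * ab.2 ^ p ^ e) : ℝ)
    · refine finsum_mem_congr rfl fun ab h => ?_
      have h1 : multiplicity ℓ (f₁ * ab.1 ^ p ^ e + f₀ * ab.2 ^ p ^ e) = 1 :=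
        multiplicity_eq_of_dvd_of_not_dvd (by simpa using h.2.1) (hsq ab h.1)
      rw [h1, Nat.cast_one]
    · refine finsum_mem_inter_support_eq _ _ _ ?_
      ext ab
      simp only [Set.mem_inter_iff, Set.mem_ofPred_eq, Function.mem_support, ne_eq,
        Nat.cast_eq_zero, multiplicity_eq_zero, not_not]
      tauto
  · rw [← Nat.card_eq_fintype_card]
    have h := (tendsto_sum_monic_irreducible Fq).const_mul 2
    rw [mul_one_div] at h
    refine h.congr fun b => ?_
    have hfin : {ℓ : Fq[X] | ℓ.Monic ∧ Irreducible ℓ ∧ ℓ.degree ≤ (b : WithBot ℕ)}.Finite := by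
      simp_rw [degree_le_natCast_iff_lt_succ]
      exact (finite_setOf_degree_lt Fq (b + 1)).subset fun ℓ hℓ => hℓ.2.2
    rw [finsum_mem_eq_finite_toFinset_sum _ hfin, finsum_mem_eq_finite_toFinset_sum _ hfin,
      Finset.mul_sum]
    refine Finset.sum_congr rfl fun ℓ hℓ => ?_
    rw [Set.Finite.mem_toFinset] at hℓ
    have hQ : 1 < (Nat.card Fq : ℝ) ^ ℓ.natDegree := one_lt_pow₀ hq hℓ.2.1.natDegree_pos.ne'
    rw [mul_comm 2 ℓ.natDegree, pow_mul]
    set Q := (Nat.card Fq : ℝ) ^ ℓ.natDegree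
    have h1 : Q - 1 ≠ 0 := by linarith
    have h2 : Q + 1 ≠ 0 := by linarith
    have h3 : Q ^ 2 - 1 = (Q - 1) * (Q + 1) := by ring
    rw [h3]
    field_simp
    ring
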